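/- arXiv:2012.07315 — 6 statements merged into one kernel-verified Lean document; each statement's English description precedes it below -/
import Mathlib

section
/- Let d ≥ 1, n ≥ 1, let f : ℤ^d → Δ^n be a categorical image with f_i(x) < 1 for all x ∈ ℤ^d, let B be a nonempty finite structuring element in ℤ^d, and let i be a category index. Then the single-category erosion ε_i(f;B) is again a categorical image: for every x ∈ ℤ^d, the vector (ε_i(f;B)(x)_k)_k has nonnegative entries that sum to 1, i.e., it lies in Δ^n. -/
/-- Grayscale dilation of `f` by the structuring element `B`:
`dilate B hB f x = max_{b in B} f (x + b)`. -/
noncomputable def dilate {d : ℕ} (B : Finset (Fin d → ℤ)) (hB : B.Nonempty)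
    (f : (Fin d → ℤ) → ℝ) (x : Fin d → ℤ) : ℝ :=
  B.sup' hB fun b => f (x + b)

/-- Grayscale erosion of `f` by the structuring element `B`:
`erode B hB f x = min_{b in B} f (x + b)`. -/
noncomputable def erode {d : ℕ} (B : Finset (Fin d → ℤ)) (hB : B.Nonempty)
    (f : (Fin d → ℤ) → ℝ) (x : Fin d → ℤ) : ℝ :=
  B.inf' hB fun b => f (x + b)

/-- `f` is a categorical image: at each pixel the value is a point of the
`n`-simplex (nonnegative coordinates summing to `1`). -/
def IsCatImage {d n : ℕ} (f : (Fin d → ℤ) → Fin (n + 1) → ℝ) : Prop :=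
  (∀ x k, 0 ≤ f x k) ∧ (∀ x, ∑ k, f x k = 1)

/-- Single-category dilation of category `i`. -/
noncomputable def catDil {d n : ℕ} (B : Finset (Fin d → ℤ)) (hB : B.Nonempty)
    (i : Fin (n + 1)) (f : (Fin d → ℤ) → Fin (n + 1) → ℝ)
    (x : Fin d → ℤ) (k : Fin (n + 1)) : ℝ :=
  if k = i then dilate B hB (fun y => f y i) x
  else if f x i < 1 then (1 - dilate B hB (fun y => f y i) x) * (f x k / (1 - f x i))
  else 0

/-- Single-category erosion of category `i` (for images with `f_i < 1` everywhere). -/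
noncomputable def catEro {d n : ℕ} (B : Finset (Fin d → ℤ)) (hB : B.Nonempty)
    (i : Fin (n + 1)) (f : (Fin d → ℤ) → Fin (n + 1) → ℝ)
    (x : Fin d → ℤ) (k : Fin (n + 1)) : ℝ :=
  if k = i then erode B hB (fun y => f y i) x
  else (1 - erode B hB (fun y => f y i) x) * (f x k / (1 - f x i))

/-- The preorder `≤_i` comparing only the `i`-th coordinate. -/
def leI {d n : ℕ} (i : Fin (n + 1)) (f g : (Fin d → ℤ) → Fin (n + 1) → ℝ) : Prop :=
  ∀ x, f x i ≤ g x i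

theorem catEro_mem_simplex {d n : ℕ} (hd : 1 ≤ d) (hn : 1 ≤ n)
    (f : (Fin d → ℤ) → Fin (n + 1) → ℝ) (hf : IsCatImage f)
    (B : Finset (Fin d → ℤ)) (hB : B.Nonempty) (i : Fin (n + 1))
    (hf1 : ∀ x, f x i < 1) :
    ∀ x, (∀ k, 0 ≤ catEro B hB i f x k) ∧ ∑ k, catEro B hB i f x k = 1 := by
  intro x
  obtain ⟨h0, h1⟩ := hf
  have hx : 0 < 1 - f x i := sub_pos.mpr (hf1 x)
  have he0 : 0 ≤ erode B hB (fun y => f y i) x :=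
    Finset.le_inf' hB _ (fun b _ => h0 (x + b) i)
  have he1 : erode B hB (fun y => f y i) x ≤ 1 := by
    obtain ⟨b, hb⟩ := hB
    exact (Finset.inf'_le _ hb).trans (hf1 (x + b)).le
  refine ⟨fun k => ?_, ?_⟩
  · unfold catEro
    split_ifs
    · exact he0
    · exact mul_nonneg (sub_nonneg.mpr he1) (div_nonneg (h0 x k) hx.le)
  · have hs := h1 x
    rw [Fintype.sum_eq_add_sum_compl i] at hs ⊢
    have hc : ∑ k ∈ {i}ᶜ, catEro B hB i f x k
        = ∑ k ∈ {i}ᶜ, (1 - erode B hB (fun y => f y i) x) * (f x k / (1 - f x i)) := by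
      refine Finset.sum_congr rfl fun k hk => ?_
      have hk' : k ≠ i := by simpa using hk
      simp [catEro, hk']
    rw [hc, ← Finset.mul_sum, ← Finset.sum_div, eq_sub_of_add_eq' hs, div_self hx.ne']
    simp [catEro]
end

section
/- Let d ≥ 1, n ≥ 1, let B be a nonempty finite symmetric structuring element in ℤ^d, let i be a category index, and let f, g : ℤ^d → Δ^n be categorical images with g_i(x) < 1 for all x ∈ ℤ^d. Then the single-category dilation and erosion form an adjunction in the preorder ≤_i: δ_i(f;B) ≤_i g if and only if f ≤_i ε_i(g;B). -/
theorem cat_adjunction {d n : ℕ} (hd : 1 ≤ d) (hn : 1 ≤ n)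
    (B : Finset (Fin d → ℤ)) (hB : B.Nonempty) (hsym : ∀ b ∈ B, -b ∈ B)
    (i : Fin (n + 1)) (f g : (Fin d → ℤ) → Fin (n + 1) → ℝ)
    (hf : IsCatImage f) (hg : IsCatImage g) (hg1 : ∀ x, g x i < 1) :
    leI i (catDil B hB i f) g ↔ leI i f (catEro B hB i g) := by
  simp only [leI, catDil, catEro, dilate, erode, if_true, Finset.sup'_le_iff, Finset.le_inf'_iff]
  constructor
  · intro h x b hb
    have := h (x + b) (-b) (hsym b hb)
    simpa using this
  · intro h x b hb
    have := h (x + b) (-b) (hsym b hb)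
    simpa using this
end

section
/- Let d ≥ 1, n ≥ 1, let B be a nonempty finite symmetric structuring element in ℤ^d, let i be a category index, and let f : ℤ^d → Δ^n be a categorical image with f_i(x) < 1 for all x ∈ ℤ^d. Then f ≤_i ε_i(δ_i(f;B);B) and δ_i(ε_i(f;B);B) ≤_i f. -/
theorem cat_extensivity {d n : ℕ} (hd : 1 ≤ d) (hn : 1 ≤ n)
    (B : Finset (Fin d → ℤ)) (hB : B.Nonempty) (hsym : ∀ b ∈ B, -b ∈ B)
    (i : Fin (n + 1)) (f : (Fin d → ℤ) → Fin (n + 1) → ℝ)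
    (hf : IsCatImage f) (hf1 : ∀ x, f x i < 1) :
    leI i f (catEro B hB i (catDil B hB i f)) ∧
      leI i (catDil B hB i (catEro B hB i f)) f := by
  constructor
  · intro x
    simp only [catEro, catDil, erode, dilate, if_true]
    refine Finset.le_inf' _ _ fun b hb => ?_
    have h := Finset.le_sup' (fun c => f (x + b + c) i) (hsym b hb)
    simpa only [add_neg_cancel_right] using h
  · intro x
    simp only [catEro, catDil, erode, dilate, if_true]
    refine Finset.sup'_le _ _ fun b hb => ?_
    have h := Finset.inf'_le (fun c => f (x + b + c) i) (hsym b hb)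
    simpa only [add_neg_cancel_right] using h
end

section
/- Let d ≥ 1, n ≥ 1, let B be a nonempty finite symmetric structuring element in ℤ^d, let i be a category index, and let f : ℤ^d → Δ^n be a categorical image with f_i(x) < 1 for all x ∈ ℤ^d. Then δ_i(ε_i(δ_i(f;B);B);B) = δ_i(f;B) as categorical images, i.e., equality holds in every coordinate k and at every pixel x, not merely in the i-th coordinate. -/
theorem dil_lt_aux {d : ℕ} (B : Finset (Fin d → ℤ)) (hB : B.Nonempty)
    (g : (Fin d → ℤ) → ℝ) (hg : ∀ x, g x < 1) (x : Fin d → ℤ) : dilate B hB g x < 1 := by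
  unfold dilate
  rw [Finset.sup'_lt_iff]
  exact fun b _ => hg _

theorem ero_lt_aux {d : ℕ} (B : Finset (Fin d → ℤ)) (hB : B.Nonempty)
    (g : (Fin d → ℤ) → ℝ) (hg : ∀ x, g x < 1) (x : Fin d → ℤ) : erode B hB g x < 1 := by
  unfold erode
  rw [Finset.inf'_lt_iff]
  obtain ⟨b, hb⟩ := hB
  exact ⟨b, hb, hg _⟩

theorem ded_aux {d : ℕ} (B : Finset (Fin d → ℤ)) (hB : B.Nonempty) (hsym : ∀ b ∈ B, -b ∈ B)
    (g : (Fin d → ℤ) → ℝ) (x : Fin d → ℤ) :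
    dilate B hB (erode B hB (dilate B hB g)) x = dilate B hB g x := by
  apply le_antisymm
  · apply Finset.sup'_le
    intro b hb
    have h := Finset.inf'_le (fun c => dilate B hB g (x + b + c)) (hsym b hb)
    simp only [add_neg_cancel_right] at h
    exact h
  · apply Finset.sup'_le
    intro b hb
    refine le_trans ?_ (Finset.le_sup' (fun c => erode B hB (dilate B hB g) (x + c)) hb)
    apply Finset.le_inf'
    intro c hc
    have h := Finset.le_sup' (fun e => g (x + b + c + e)) (hsym c hc)
    simp only [add_neg_cancel_right] at h
    exact h

theorem cat_dil_ero_dil {d n : ℕ} (hd : 1 ≤ d) (hn : 1 ≤ n)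
    (B : Finset (Fin d → ℤ)) (hB : B.Nonempty) (hsym : ∀ b ∈ B, -b ∈ B)
    (i : Fin (n + 1)) (f : (Fin d → ℤ) → Fin (n + 1) → ℝ)
    (hf : IsCatImage f) (hf1 : ∀ x, f x i < 1) :
    catDil B hB i (catEro B hB i (catDil B hB i f)) = catDil B hB i f := by
  have hD := dil_lt_aux B hB (fun y => f y i) hf1
  have hE := ero_lt_aux B hB _ hD
  have h1 : ∀ y, catDil B hB i f y i = dilate B hB (fun y => f y i) y := by
    intro y; simp [catDil]
  have h2 : ∀ y, catEro B hB i (catDil B hB i f) y i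
      = erode B hB (dilate B hB (fun y => f y i)) y := by
    intro y; simp [catEro, catDil]
  funext x k
  have h3 := ded_aux B hB hsym (fun y => f y i) x
  have hDx := hD x
  have hEx := hE x
  by_cases hk : k = i
  · subst hk
    rw [h1, ← h3]
    simp only [catDil, if_true]
    congr 1
    funext y
    exact h2 y
  · rw [catDil]
    simp only [h2, h3, hk, hEx, if_true, if_false]
    rw [catEro]
    simp only [h1, hk, if_false]
    rw [catDil]
    simp only [hk, hf1 x, if_true, if_false]
    have e1 : 1 - dilate B hB (fun y => f y i) x ≠ 0 := by linarith
    have e2 : 1 - erode B hB (dilate B hB (fun y => f y i)) x ≠ 0 := by linarith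
    rw [mul_div_cancel_left₀ _ e1, mul_div_cancel_left₀ _ e2]
end

section
/- Let d ≥ 1, n ≥ 1, let B be a nonempty finite symmetric structuring element in ℤ^d, let i be a category index, and let f : ℤ^d → Δ^n be a categorical image with f_i(x) < 1 for all x ∈ ℤ^d. Then the single-category opening γ_i(f;B) = δ_i(ε_i(f;B);B) is idempotent as a map on categorical images: γ_i(γ_i(f;B);B) = γ_i(f;B), with equality in every coordinate at every pixel. -/
theorem dilate_mono_aux {d : ℕ} (B : Finset (Fin d → ℤ)) (hB : B.Nonempty)
    {f g : (Fin d → ℤ) → ℝ} (h : ∀ x, f x ≤ g x) (x : Fin d → ℤ) :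
    dilate B hB f x ≤ dilate B hB g x :=
  Finset.sup'_le hB _ fun b hb =>
    (h (x + b)).trans (Finset.le_sup' (fun b => g (x + b)) hb)

theorem erode_mono_aux {d : ℕ} (B : Finset (Fin d → ℤ)) (hB : B.Nonempty)
    {f g : (Fin d → ℤ) → ℝ} (h : ∀ x, f x ≤ g x) (x : Fin d → ℤ) :
    erode B hB f x ≤ erode B hB g x :=
  Finset.le_inf' hB _ fun b hb =>
    (Finset.inf'_le (fun b => f (x + b)) hb).trans (h (x + b))

theorem open_le_aux {d : ℕ} (B : Finset (Fin d → ℤ)) (hB : B.Nonempty)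
    (hsym : ∀ b ∈ B, -b ∈ B) (f : (Fin d → ℤ) → ℝ) (x : Fin d → ℤ) :
    dilate B hB (erode B hB f) x ≤ f x := by
  refine Finset.sup'_le hB _ fun b hb => ?_
  have := Finset.inf'_le (fun c => f (x + b + c)) (hsym b hb)
  simp only [add_neg_cancel_right] at this
  exact this

theorem le_close_aux {d : ℕ} (B : Finset (Fin d → ℤ)) (hB : B.Nonempty)
    (hsym : ∀ b ∈ B, -b ∈ B) (f : (Fin d → ℤ) → ℝ) (x : Fin d → ℤ) :
    f x ≤ erode B hB (dilate B hB f) x := by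
  refine Finset.le_inf' hB _ fun b hb => ?_
  have := Finset.le_sup' (fun c => f (x + b + c)) (hsym b hb)
  simp only [add_neg_cancel_right] at this
  exact this

theorem erode_lt_aux {d : ℕ} (B : Finset (Fin d → ℤ)) (hB : B.Nonempty)
    {f : (Fin d → ℤ) → ℝ} (h : ∀ x, f x < 1) (x : Fin d → ℤ) : erode B hB f x < 1 := by
  obtain ⟨b, hb⟩ := hB
  exact (Finset.inf'_le (fun b => f (x + b)) hb).trans_lt (h _)

theorem opening_coord_i {d n : ℕ} (B : Finset (Fin d → ℤ)) (hB : B.Nonempty)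
    (i : Fin (n + 1)) (f : (Fin d → ℤ) → Fin (n + 1) → ℝ) (x : Fin d → ℤ) :
    catDil B hB i (catEro B hB i f) x i =
      dilate B hB (erode B hB (fun y => f y i)) x := by
  simp only [catDil, catEro, if_true]

theorem opening_coord_k {d n : ℕ} (B : Finset (Fin d → ℤ)) (hB : B.Nonempty)
    (i : Fin (n + 1)) (f : (Fin d → ℤ) → Fin (n + 1) → ℝ) (hf1 : ∀ x, f x i < 1)
    (x : Fin d → ℤ) (k : Fin (n + 1)) (hk : k ≠ i) :
    catDil B hB i (catEro B hB i f) x k =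
      (1 - dilate B hB (erode B hB (fun y => f y i)) x) * (f x k / (1 - f x i)) := by
  have h := erode_lt_aux B hB hf1 x
  have h' : 1 - erode B hB (fun y => f y i) x ≠ 0 := by linarith
  simp only [catDil, catEro, if_true, if_neg hk, if_pos h]
  rw [mul_div_cancel_left₀ _ h']

theorem cat_opening_idempotent {d n : ℕ} (hd : 1 ≤ d) (hn : 1 ≤ n)
    (B : Finset (Fin d → ℤ)) (hB : B.Nonempty) (hsym : ∀ b ∈ B, -b ∈ B)
    (i : Fin (n + 1)) (f : (Fin d → ℤ) → Fin (n + 1) → ℝ)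
    (hf : IsCatImage f) (hf1 : ∀ x, f x i < 1) :
    catDil B hB i (catEro B hB i (catDil B hB i (catEro B hB i f))) =
      catDil B hB i (catEro B hB i f) := by
  have hlt : ∀ x, dilate B hB (erode B hB (fun y => f y i)) x < 1 := fun x =>
    (open_le_aux B hB hsym _ x).trans_lt (hf1 x)
  have hidem : ∀ x, dilate B hB (erode B hB
      (fun y => dilate B hB (erode B hB (fun y => f y i)) y)) x =
      dilate B hB (erode B hB (fun y => f y i)) x := fun x =>
    le_antisymm (open_le_aux B hB hsym _ x)
      (dilate_mono_aux B hB (le_close_aux B hB hsym _) x)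
  funext x k
  by_cases hk : k = i
  · subst hk
    rw [opening_coord_i]
    simp only [opening_coord_i]
    exact hidem x
  · rw [opening_coord_k B hB i _ (fun x => by rw [opening_coord_i]; exact hlt x) x k hk]
    simp only [opening_coord_i]
    rw [hidem x]
    have := hlt x
    exact mul_div_cancel₀ _ (by linarith)
end

section
/- Let d ≥ 1, n ≥ 1, let B be a nonempty finite structuring element in ℤ^d containing the origin, and let i be a category index. Let f : ℤ^d → Δ^n be a crisp categorical image, i.e., for every x there is a category c(x) with f(x) = e_{c(x)}, the standard basis vector. Then the single-category dilation agrees with n-ary dilation on crisp images: for every x ∈ ℤ^d, if there exists b ∈ B with f(x+b) = e_i then δ_i(f;B)(x) = e_i, and otherwise δ_i(f;B)(x) = f(x). In particular δ_i maps crisp images to crisp images. -/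
/-- The standard basis vector `e_c` of the `n`-simplex. -/
def eVec (n : ℕ) (c : Fin (n + 1)) : Fin (n + 1) → ℝ :=
  fun k => if k = c then 1 else 0

theorem eVec_other (n : ℕ) (c i : Fin (n + 1)) (h : eVec n c ≠ eVec n i) :
    eVec n c i = 0 := by
  have : i ≠ c := by
    rintro rfl
    exact h rfl
  simp [eVec, this]

theorem eVec_le (n : ℕ) (c i : Fin (n + 1)) : eVec n c i ≤ 1 := by
  unfold eVec
  split_ifs <;> norm_num

theorem catDil_crisp {d n : ℕ} (hd : 1 ≤ d) (hn : 1 ≤ n)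
    (B : Finset (Fin d → ℤ)) (hB : B.Nonempty) (h0 : (0 : Fin d → ℤ) ∈ B)
    (i : Fin (n + 1)) (f : (Fin d → ℤ) → Fin (n + 1) → ℝ)
    (hcrisp : ∀ x, ∃ c, f x = eVec n c) :
    (∀ x, ((∃ b ∈ B, f (x + b) = eVec n i) → catDil B hB i f x = eVec n i) ∧
        ((¬ ∃ b ∈ B, f (x + b) = eVec n i) → catDil B hB i f x = f x)) ∧
      (∀ x, ∃ c, catDil B hB i f x = eVec n c) := by
  have key : ∀ x, ((∃ b ∈ B, f (x + b) = eVec n i) → catDil B hB i f x = eVec n i) ∧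
        ((¬ ∃ b ∈ B, f (x + b) = eVec n i) → catDil B hB i f x = f x) := by
    intro x
    constructor
    · rintro ⟨b, hb, hfb⟩
      have hD : dilate B hB (fun y => f y i) x = 1 := by
        apply le_antisymm
        · apply Finset.sup'_le
          intro a _
          obtain ⟨c, hc⟩ := hcrisp (x + a)
          simp only [hc]
          exact eVec_le n c i
        · have h1 : f (x + b) i = 1 := by rw [hfb]; simp [eVec]
          rw [← h1]
          exact Finset.le_sup' (fun b => f (x + b) i) hb
      funext k
      unfold catDil
      rw [hD]
      simp [eVec]
    · intro hne
      have hz : ∀ b ∈ B, f (x + b) i = 0 := by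
        intro b hb
        obtain ⟨c, hc⟩ := hcrisp (x + b)
        rw [hc]
        apply eVec_other
        intro h
        exact hne ⟨b, hb, hc.trans h⟩
      have hx : f x i = 0 := by simpa using hz 0 h0
      have hD : dilate B hB (fun y => f y i) x = 0 := by
        apply le_antisymm
        · exact Finset.sup'_le _ _ fun a ha => (hz a ha).le
        · rw [← hz 0 h0]
          exact Finset.le_sup' (fun b => f (x + b) i) h0
      funext k
      unfold catDil
      rw [hD, hx]
      by_cases hk : k = i
      · subst hk
        simp [hx]
      · simp [hk]
  refine ⟨key, fun x => ?_⟩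
  by_cases h : ∃ b ∈ B, f (x + b) = eVec n i
  · exact ⟨i, (key x).1 h⟩
  · obtain ⟨c, hc⟩ := hcrisp x
    exact ⟨c, ((key x).2 h).trans hc⟩
end
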